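/- arXiv:2311.11907 — 6 statements merged into one kernel-verified Lean document; each statement's English description precedes it below -/
import Mathlib

section
/- Let x₁,x₂,x₃ ∈ 𝕆 and λ₁,λ₂,λ₃ ∈ ℝ with λ₁ ≠ 0. Then the six Veronese conditions λ₁·conj(x₁) = x₂·x₃, λ₂·conj(x₂) = x₃·x₁, λ₃·conj(x₃) = x₁·x₂, n(x₁) = λ₂λ₃, n(x₂) = λ₃λ₁, n(x₃) = λ₁λ₂ hold if and only if the three conditions λ₁·conj(x₁) = x₂·x₃, n(x₂) = λ₃λ₁, n(x₃) = λ₁λ₂ hold. -/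
/- Octonions via the Cayley–Dickson construction over the quaternions. -/

noncomputable section

open Quaternion

/-- The octonions, as pairs of quaternions. -/
abbrev Oct : Type := ℍ[ℝ] × ℍ[ℝ]

/-- Cayley–Dickson multiplication: (a,b)·(c,d) = (a·c − conj(d)·b, d·a + b·conj(c)). -/
def omul (x y : Oct) : Oct :=
  ⟨x.1 * y.1 - star y.2 * x.2, y.2 * x.1 + x.2 * star y.1⟩

/-- Octonionic conjugation: conj(a,b) = (conj a, −b). -/
def oconj (x : Oct) : Oct := ⟨star x.1, -x.2⟩

/-- The octonionic unit. -/
def oone : Oct := ⟨1, 0⟩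

/-- The octonionic norm: the sum of the squares of the eight real coordinates. -/
def onorm (x : Oct) : ℝ := Quaternion.normSq x.1 + Quaternion.normSq x.2

lemma oconj_oconj (x : Oct) : oconj (oconj x) = x := by
  simp [oconj]

lemma oconj_smul (r : ℝ) (x : Oct) : oconj (r • x) = r • oconj x := by
  simp [oconj]

lemma omul_smul (r : ℝ) (x y : Oct) : omul x (r • y) = r • omul x y := by
  simp [omul, smul_sub, smul_add]

lemma smul_omul (r : ℝ) (x y : Oct) : omul (r • x) y = r • omul x y := by
  simp [omul, smul_sub, smul_add]

lemma oconj_omul (x y : Oct) : oconj (omul x y) = omul (oconj y) (oconj x) := by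
  simp only [oconj, omul, star_sub, star_mul, star_star, star_neg, neg_add_rev,
    neg_mul, mul_neg, neg_neg]

lemma onorm_oconj (x : Oct) : onorm (oconj x) = onorm x := by
  simp [onorm, oconj]

lemma onorm_smul (r : ℝ) (x : Oct) : onorm (r • x) = r ^ 2 * onorm x := by
  simp [onorm, Quaternion.normSq_smul, mul_add]

/-- The octonionic norm is multiplicative. -/
lemma onorm_omul (x y : Oct) : onorm (omul x y) = onorm x * onorm y := by
  simp [onorm, omul, Quaternion.normSq_def']
  ring

/-- Left alternativity, in the form `x (x̄ y) = n(x) y`. -/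
lemma omul_oconj_omul (x y : Oct) : omul x (omul (oconj x) y) = onorm x • y := by
  ext <;> simp [onorm, omul, oconj, Quaternion.normSq_def'] <;> ring

/-- Right alternativity, in the form `(x ȳ) y = n(y) x`. -/
lemma omul_omul_oconj (x y : Oct) : omul (omul x (oconj y)) y = onorm y • x := by
  ext <;> simp [onorm, omul, oconj, Quaternion.normSq_def'] <;> ring

/-- for `λ₁ ≠ 0`, the six Veronese conditions are equivalent to three of them. -/
theorem veronese_reduction (x₁ x₂ x₃ : Oct) (l₁ l₂ l₃ : ℝ) (hl₁ : l₁ ≠ 0) :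
    (l₁ • oconj x₁ = omul x₂ x₃ ∧ l₂ • oconj x₂ = omul x₃ x₁ ∧ l₃ • oconj x₃ = omul x₁ x₂ ∧
      onorm x₁ = l₂ * l₃ ∧ onorm x₂ = l₃ * l₁ ∧ onorm x₃ = l₁ * l₂) ↔
    (l₁ • oconj x₁ = omul x₂ x₃ ∧ onorm x₂ = l₃ * l₁ ∧ onorm x₃ = l₁ * l₂) := by
  refine ⟨fun ⟨h₁, _, _, _, h₂, h₃⟩ ↦ ⟨h₁, h₂, h₃⟩, fun ⟨h₁, h₂, h₃⟩ ↦ ?_⟩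
  have hx₁ : l₁ • x₁ = omul (oconj x₃) (oconj x₂) := by
    rw [← oconj_omul, ← h₁, oconj_smul, oconj_oconj]
  refine ⟨h₁, ?_, ?_, ?_, h₂, h₃⟩
  · apply smul_right_injective Oct hl₁
    simp only [← omul_smul, hx₁, omul_oconj_omul, h₃, mul_smul]
  · apply smul_right_injective Oct hl₁
    simp only [← smul_omul, hx₁, omul_omul_oconj, h₂, mul_comm l₃, mul_smul]
  · have h := congrArg onorm h₁
    rw [onorm_smul, onorm_oconj, onorm_omul, h₂, h₃] at h
    apply mul_left_cancel₀ (pow_ne_zero 2 hl₁)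
    linear_combination h
end
end

section
/- The norm of the Okubo algebra is multiplicative: n(x*y) = n(x)·n(y) for all x, y ∈ 𝒪. -/
/- The real Okubo algebra: traceless Hermitian 3×3 complex matrices with the
Okubo product x*y = μ·(xy) + conj(μ)·(yx) − (1/3)·Tr(xy)·I, μ = (3 + i√3)/6. -/

noncomputable section

open Matrix

/-- 3×3 complex matrices. -/
abbrev OkM : Type := Matrix (Fin 3) (Fin 3) ℂ

/-- The parameter μ = (3 + i√3)/6. -/
def okMu : ℂ := (3 + (Real.sqrt 3 : ℝ) * Complex.I) / 6

/-- Membership in the Okubo algebra: Hermitian and traceless. -/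
def IsOkubo (x : OkM) : Prop := x.IsHermitian ∧ x.trace = 0

/-- The Okubo product x*y = μ·(xy) + conj(μ)·(yx) − (1/3)·Tr(xy)·I. -/
def okmul (x y : OkM) : OkM :=
  okMu • (x * y) + (starRingEnd ℂ) okMu • (y * x) - ((1 / 3 : ℂ) * (x * y).trace) • (1 : OkM)

/-- The Okubo norm n(x) = (1/6)·Tr(x²). -/
def oknorm (x : OkM) : ℝ := ((1 / 6 : ℂ) * (x * x).trace).re

/-- Polarization of `2 tr (x⁴) = (tr (x²))²`, which follows from the Cayley-Hamilton theorem for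
traceless 3×3 matrices. -/
theorem Matrix.trace_polarized_fourth_power {R : Type*} [CommRing R]
    (x y : Matrix (Fin 3) (Fin 3) R) (hx : x.trace = 0) (hy : y.trace = 0) :
    2 * (x * y * (x * y)).trace + 4 * (x * x * (y * y)).trace =
      2 * (x * y).trace ^ 2 + (x * x).trace * (y * y).trace := by
  simp only [Matrix.trace_fin_three] at hx hy
  have hx' : x 2 2 = -x 0 0 - x 1 1 := by linear_combination hx
  have hy' : y 2 2 = -y 0 0 - y 1 1 := by linear_combination hy
  simp only [Matrix.trace_fin_three, Matrix.mul_apply, Fin.sum_univ_three, hx', hy']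
  ring

theorem Matrix.IsHermitian.conj_trace_sq {n : Type*} [Fintype n] {x : Matrix n n ℂ}
    (hx : x.IsHermitian) : (starRingEnd ℂ) (x * x).trace = (x * x).trace := by
  rw [starRingEnd_apply, ← Matrix.trace_conjTranspose, Matrix.conjTranspose_mul, hx.eq]

theorem okMu_add_conj : okMu + (starRingEnd ℂ) okMu = 1 := by
  simp only [okMu, map_div₀, map_add, map_mul, Complex.conj_ofReal, Complex.conj_I, map_ofNat]
  ring

theorem okMu_mul_conj : okMu * (starRingEnd ℂ) okMu = 1 / 3 := by
  have h : ((Real.sqrt 3 : ℝ) : ℂ) ^ 2 = 3 := by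
    rw [← Complex.ofReal_pow, Real.sq_sqrt (by norm_num)]; norm_num
  simp only [okMu, map_div₀, map_add, map_mul, Complex.conj_ofReal, Complex.conj_I, map_ofNat]
  linear_combination (1 / 36 : ℂ) * h - ((Real.sqrt 3 : ℝ) : ℂ) ^ 2 / 36 * Complex.I_sq

theorem trace_okmul_sq (x y : OkM) :
    (okmul x y * okmul x y).trace =
      1 / 3 * ((x * y * (x * y)).trace + 2 * (x * x * (y * y)).trace - (x * y).trace ^ 2) := by
  have h₁ : (y * x * (y * x)).trace = (x * y * (x * y)).trace := by
    rw [Matrix.mul_assoc, Matrix.trace_mul_comm y]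
    simp only [Matrix.mul_assoc]
  have h₂ : (x * y * (y * x)).trace = (x * x * (y * y)).trace := by
    rw [← Matrix.mul_assoc, Matrix.trace_mul_comm _ x]
    simp only [Matrix.mul_assoc]
  have h₃ : (y * x * (x * y)).trace = (x * x * (y * y)).trace := by
    rw [Matrix.trace_mul_comm, h₂]
  simp only [okmul, Matrix.mul_sub, Matrix.sub_mul, Matrix.mul_add, Matrix.add_mul,
    Matrix.smul_mul, Matrix.mul_smul, Matrix.mul_one, Matrix.one_mul, Matrix.trace_sub,
    Matrix.trace_add, Matrix.trace_smul, smul_eq_mul, Matrix.trace_one, Fintype.card_fin,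
    h₁, h₂, h₃, Matrix.trace_mul_comm y x]
  have hc : (starRingEnd ℂ) okMu = 1 - okMu := by linear_combination okMu_add_conj
  have hm := okMu_mul_conj
  rw [hc] at hm ⊢
  push_cast
  linear_combination (2 * (x * x * (y * y)).trace - 2 * (x * y * (x * y)).trace) * hm


/-- STATEMENT 10: the Okubo norm is multiplicative. -/
theorem okubo_norm_multiplicative (x y : OkM) (hx : IsOkubo x) (hy : IsOkubo y) :
    oknorm (okmul x y) = oknorm x * oknorm y := by
  have hs : (okmul x y * okmul x y).trace = 1 / 6 * ((x * x).trace * (y * y).trace) := by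
    rw [trace_okmul_sq]
    linear_combination (1 / 6 : ℂ) * Matrix.trace_polarized_fourth_power x y hx.2 hy.2
  obtain ⟨a, ha⟩ := Complex.conj_eq_iff_real.1 hx.1.conj_trace_sq
  obtain ⟨b, hb⟩ := Complex.conj_eq_iff_real.1 hy.1.conj_trace_sq
  rw [oknorm, oknorm, oknorm, hs, ha, hb]
  simp
  ring
end
end

section
/- The Okubo algebra is flexible: x*(y*x) = (x*y)*x for all x, y ∈ 𝒪. -/
/- The real Okubo algebra: traceless Hermitian 3×3 complex matrices with the
Okubo product x*y = μ·(xy) + conj(μ)·(yx) − (1/3)·Tr(xy)·I, μ = (3 + i√3)/6. -/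

noncomputable section

open Matrix

/-- STATEMENT 11: the Okubo algebra is flexible. -/
theorem okubo_flexible (x y : OkM) (hx : IsOkubo x) (hy : IsOkubo y) :
    okmul x (okmul y x) = okmul (okmul x y) x := by
  have hyx : (y * x).trace = (x * y).trace := trace_mul_comm y x
  have hxyx : (x * (y * x)).trace = (x * (x * y)).trace := by
    rw [← Matrix.mul_assoc, trace_mul_comm]
  have hyxx : (y * (x * x)).trace = (x * (x * y)).trace := by
    rw [trace_mul_comm, Matrix.mul_assoc]
  simp only [okmul, hyx, Matrix.mul_sub, Matrix.sub_mul, Matrix.mul_add, Matrix.add_mul,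
    Matrix.mul_smul, Matrix.smul_mul, Matrix.mul_one, Matrix.one_mul, Matrix.mul_assoc,
    trace_sub, trace_add, trace_smul, hxyx, hyxx]
  module
end
end

section
/- The norm of the Okubo algebra is associative: the trace bilinear form b(x,y) = (1/6)·Tr(xy) (a real number for Hermitian x,y) satisfies b(x*y, z) = b(x, y*z) for all x, y, z ∈ 𝒪. -/
/- The real Okubo algebra: traceless Hermitian 3×3 complex matrices with the
Okubo product x*y = μ·(xy) + conj(μ)·(yx) − (1/3)·Tr(xy)·I, μ = (3 + i√3)/6. -/

noncomputable section

open Matrix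

/-- The trace bilinear form b(x,y) = (1/6)·Tr(xy). -/
def okform (x y : OkM) : ℝ := ((1 / 6 : ℂ) * (x * y).trace).re

/-- `Tr((x*y)z) = Tr(x(y*z))` holds already over `ℂ`, for traceless `x` and `z`. -/
theorem trace_okmul_mul {x z : OkM} (y : OkM) (hx : x.trace = 0) (hz : z.trace = 0) :
    (okmul x y * z).trace = (x * okmul y z).trace := by
  have h : (y * x * z).trace = (x * (z * y)).trace := by
    rw [Matrix.mul_assoc, Matrix.trace_mul_comm, Matrix.mul_assoc]
  simp [okmul, Matrix.add_mul, Matrix.sub_mul, Matrix.mul_add, Matrix.mul_sub, hx, hz, h,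
    Matrix.mul_assoc x y z]

/-- STATEMENT 12: the Okubo norm is associative: b(x*y, z) = b(x, y*z). -/
theorem okubo_norm_associative (x y z : OkM) (hx : IsOkubo x) (hy : IsOkubo y)
    (hz : IsOkubo z) :
    okform (okmul x y) z = okform x (okmul y z) := by
  rw [okform, okform, trace_okmul_mul y hx.2 hz.2]
end
end

section
/- Let e = diag(2,−1,−1) ∈ 𝒪. Then e*e = e and n(e) = 1, and the derived product x·y := (e*x)*(y*e) on 𝒪 makes e a two-sided unit (x·e = e·x = x for all x ∈ 𝒪) and satisfies n(x·y) = n(x)·n(y) for all x, y ∈ 𝒪; thus (𝒪, ·, n) is an 8-dimensional unital composition algebra (isomorphic to the octonions). -/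
/- The real Okubo algebra: traceless Hermitian 3×3 complex matrices with the
Okubo product x*y = μ·(xy) + conj(μ)·(yx) − (1/3)·Tr(xy)·I, μ = (3 + i√3)/6. -/

noncomputable section

open Matrix

/-- The idempotent e = diag(2,−1,−1) of the Okubo algebra. -/
def okE : OkM := Matrix.diagonal ![2, -1, -1]

/-- The derived (octonionic) product x·y = (e*x)*(y*e). -/
def okDmul (x y : OkM) : OkM := okmul (okmul okE x) (okmul y okE)

/-- The conjugation conj(x) = ((x*e)*e)*e. -/
def okConj (x : OkM) : OkM := okmul (okmul (okmul x okE) okE) okE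

/-- The order-three automorphism τ(x) = (((x*e)*e)*e)*e. -/
def okTau (x : OkM) : OkM := okmul (okmul (okmul (okmul x okE) okE) okE) okE

/-- The quadratic form `(1/6)·Tr(x²)` with complex values. -/
def okQuad (x : OkM) : ℂ := (1 / 6 : ℂ) * (x * x).trace

/-- The polarized Cayley–Hamilton identity for traceless 3×3 matrices. -/
theorem traceless_polarized_cayley_hamilton {x y : OkM} (hx : x.trace = 0) (hy : y.trace = 0) :
    x * x * y + x * y * x + y * x * x
      = (x * y).trace • x + ((1 / 2 : ℂ) * (x * x).trace) • y + (x * x * y).trace • (1 : OkM) := by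
  have hx' : x 2 2 = -x 0 0 - x 1 1 := by
    rw [Matrix.trace_fin_three] at hx
    linear_combination hx
  have hy' : y 2 2 = -y 0 0 - y 1 1 := by
    rw [Matrix.trace_fin_three] at hy
    linear_combination hy
  ext i j
  fin_cases i <;> fin_cases j <;>
    simp [Matrix.mul_apply, Fin.sum_univ_three, Matrix.trace_fin_three, hx', hy'] <;> ring

theorem trace_okmul (x y : OkM) : (okmul x y).trace = 0 := by
  simp only [okmul, Matrix.trace_sub, Matrix.trace_add, Matrix.trace_smul, Matrix.trace_one,
    Fintype.card_fin, smul_eq_mul, Matrix.trace_mul_comm y x]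
  push_cast
  linear_combination (x * y).trace * okMu_add_conj

theorem okmul_okmul_left {x y : OkM} (hx : x.trace = 0) (hy : y.trace = 0) :
    okmul (okmul x y) x = okQuad x • y := by
  have htr : (okmul x y * x).trace = (x * x * y).trace := by
    have h₁ : (x * y * x).trace = (x * x * y).trace := by
      rw [Matrix.trace_mul_comm, Matrix.mul_assoc]
    have h₂ : (y * x * x).trace = (x * x * y).trace := by
      rw [Matrix.mul_assoc, Matrix.trace_mul_comm]
    simp only [okmul, Matrix.sub_mul, Matrix.add_mul, Matrix.smul_mul, Matrix.one_mul,
      Matrix.trace_sub, Matrix.trace_add, Matrix.trace_smul, smul_eq_mul, h₁, h₂, hx]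
    linear_combination (x * x * y).trace * okMu_add_conj
  have hadd := okMu_add_conj
  have hmul := okMu_mul_conj
  have hch := traceless_polarized_cayley_hamilton hx hy
  rw [okmul, htr]
  simp only [okmul, okQuad]
  have hsq : okMu ^ 2 + (starRingEnd ℂ) okMu ^ 2 = 1 / 3 := by
    linear_combination (okMu + (starRingEnd ℂ) okMu + 1) * hadd - 2 * hmul
  generalize (starRingEnd ℂ) okMu = m' at *
  generalize okMu = m at *
  simp only [Matrix.sub_mul, Matrix.add_mul, Matrix.smul_mul, Matrix.one_mul, Matrix.mul_sub,
    Matrix.mul_add, Matrix.mul_smul, Matrix.mul_one, ← Matrix.mul_assoc]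
  linear_combination (norm := module) (1 / 3 : ℂ) • hch + hsq • (x * y * x)
    + hmul • (x * x * y + y * x * x) - (1 / 3 * (x * y).trace * hadd) • x

theorem okmul_okmul_right {x y : OkM} (hx : x.trace = 0) (hy : y.trace = 0) :
    okmul x (okmul y x) = okQuad x • y := by
  have htr : (x * okmul y x).trace = (x * x * y).trace := by
    have h₁ : (x * y * x).trace = (x * x * y).trace := by
      rw [Matrix.trace_mul_comm, Matrix.mul_assoc]
    simp only [okmul, Matrix.mul_sub, Matrix.mul_add, Matrix.mul_smul, Matrix.mul_one, ← Matrix.mul_assoc,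
      Matrix.trace_sub, Matrix.trace_add, Matrix.trace_smul, smul_eq_mul, h₁, hx]
    linear_combination (x * x * y).trace * okMu_add_conj
  have hadd := okMu_add_conj
  have hmul := okMu_mul_conj
  have hch := traceless_polarized_cayley_hamilton hx hy
  rw [okmul, htr]
  simp only [okmul, okQuad, Matrix.trace_mul_comm y x]
  have hsq : okMu ^ 2 + (starRingEnd ℂ) okMu ^ 2 = 1 / 3 := by
    linear_combination (okMu + (starRingEnd ℂ) okMu + 1) * hadd - 2 * hmul
  generalize (starRingEnd ℂ) okMu = m' at *
  generalize okMu = m at *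
  simp only [Matrix.sub_mul, Matrix.add_mul, Matrix.smul_mul, Matrix.one_mul, Matrix.mul_sub,
    Matrix.mul_add, Matrix.mul_smul, Matrix.mul_one, ← Matrix.mul_assoc]
  linear_combination (norm := module) (1 / 3 : ℂ) • hch + hsq • (x * y * x)
    + hmul • (x * x * y + y * x * x) - (1 / 3 * (x * y).trace * hadd) • x

theorem okQuad_okmul {x y : OkM} (hx : x.trace = 0) (hy : y.trace = 0) :
    okQuad (okmul x y) = okQuad x * okQuad y := by
  rw [okQuad, trace_okmul_mul y hx (trace_okmul x y), okmul_okmul_right hy hx, Matrix.mul_smul,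
    Matrix.trace_smul, smul_eq_mul, okQuad, okQuad]
  ring

theorem trace_okE : okE.trace = 0 := by
  simp [okE, Fin.sum_univ_three]
  norm_num

theorem okQuad_okE : okQuad okE = 1 := by
  simp [okQuad, okE, Fin.sum_univ_three]
  norm_num

theorem okmul_okE_okE : okmul okE okE = okE := by
  have h : okmul okE okE = okE * okE - ((1 / 3 : ℂ) * (okE * okE).trace) • (1 : OkM) := by
    rw [okmul, ← add_smul, okMu_add_conj, one_smul]
  rw [h]
  ext i j
  fin_cases i <;> fin_cases j <;> simp [okE, Fin.sum_univ_three] <;> norm_num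

theorem okQuad_okDmul {x y : OkM} (hx : x.trace = 0) (hy : y.trace = 0) :
    okQuad (okDmul x y) = okQuad x * okQuad y := by
  rw [okDmul, okQuad_okmul (trace_okmul _ _) (trace_okmul _ _), okQuad_okmul trace_okE hx,
    okQuad_okmul hy trace_okE, okQuad_okE, one_mul, mul_one]

theorem okQuad_im_of_isHermitian {x : OkM} (hx : x.IsHermitian) : (okQuad x).im = 0 := by
  rw [← Complex.conj_eq_iff_im, okQuad, map_mul, starRingEnd_apply (x * x).trace,
    ← Matrix.trace_conjTranspose, Matrix.conjTranspose_mul, hx.eq]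
  simp [map_ofNat]

/-- STATEMENT 15: e = diag(2,−1,−1) is an idempotent of norm 1, and the derived
product x·y = (e*x)*(y*e) makes the Okubo algebra a unital composition algebra
with unit e (isomorphic to the octonions). -/
theorem okubo_derived_octonions :
    okmul okE okE = okE ∧ oknorm okE = 1 ∧
    (∀ x : OkM, IsOkubo x → okDmul x okE = x ∧ okDmul okE x = x) ∧
    (∀ x y : OkM, IsOkubo x → IsOkubo y → oknorm (okDmul x y) = oknorm x * oknorm y) := by
  refine ⟨okmul_okE_okE, ?_, fun x hx => ⟨?_, ?_⟩, fun x y hx hy => ?_⟩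
  · change (okQuad okE).re = 1
    rw [okQuad_okE, Complex.one_re]
  · rw [okDmul, okmul_okE_okE, okmul_okmul_left trace_okE hx.2, okQuad_okE, one_smul]
  · rw [okDmul, okmul_okE_okE, okmul_okmul_right trace_okE hx.2, okQuad_okE, one_smul]
  · change (okQuad (okDmul x y)).re = (okQuad x).re * (okQuad y).re
    rw [okQuad_okDmul hx.2 hy.2, Complex.mul_re, okQuad_im_of_isHermitian hx.1, zero_mul, sub_zero]
end
end

section
/- Let e = diag(2,−1,−1) ∈ 𝒪, let x·y := (e*x)*(y*e) be the derived octonionic product, define conj(x) := ((x*e)*e)*e and τ(x) := (((x*e)*e)*e)*e. Then for all x, y ∈ 𝒪: (i) conj(x) = τ(e*x); (ii) conj(conj(x)) = x; (iii) conj is an anti-homomorphism for the derived product, conj(x·y) = conj(y)·conj(x); and (iv) x·conj(x) = n(x)·e. -/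
/- The real Okubo algebra: traceless Hermitian 3×3 complex matrices with the
Okubo product x*y = μ·(xy) + conj(μ)·(yx) − (1/3)·Tr(xy)·I, μ = (3 + i√3)/6. -/

noncomputable section

open Matrix

theorem okMu_conj : (starRingEnd ℂ) okMu = 1 - okMu := by
  simp only [okMu, map_div₀, map_add, map_mul, Complex.conj_I, Complex.conj_ofReal, map_ofNat]
  ring

theorem okMu_sq : okMu ^ 2 = okMu - 1 / 3 := by
  have h : ((Real.sqrt 3 : ℝ) : ℂ) ^ 2 = 3 := by
    rw [← Complex.ofReal_pow, Real.sq_sqrt (by norm_num)]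
    norm_num
  rw [okMu]
  linear_combination (Complex.I ^ 2 / 36) * h + (1 / 12) * Complex.I_sq

/-- The primitive sixth root of unity by which multiplication by `okE` acts on off-diagonal
entries. -/
def okRoot : ℂ := 3 * okMu - 1

theorem okRoot_sq : okRoot ^ 2 = okRoot - 1 := by
  rw [okRoot]
  linear_combination 9 * okMu_sq

theorem okMu_eq : okMu = (1 + okRoot) / 3 := by
  rw [okRoot]
  ring

theorem okmul_apply (x y : OkM) (i j : Fin 3) :
    okmul x y i j = (1 + okRoot) / 3 * (x * y) i j + (2 - okRoot) / 3 * (y * x) i j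
      - (x * y).trace / 3 * (1 : OkM) i j := by
  rw [okmul, okMu_conj, okMu_eq]
  simp only [Matrix.add_apply, Matrix.sub_apply, Matrix.smul_apply, smul_eq_mul]
  ring

theorem apply_two_two_of_trace {x : OkM} (h : x.trace = 0) : x 2 2 = -x 0 0 - x 1 1 := by
  rw [Matrix.trace_fin_three] at h
  linear_combination h

theorem okmul_okE {x : OkM} (h : x.trace = 0) :
    okmul x okE = !![x 0 0, (1 - okRoot) * x 0 1, (1 - okRoot) * x 0 2;
      okRoot * x 1 0, x 2 2, -x 1 2;
      okRoot * x 2 0, -x 2 1, x 1 1] := by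
  have := apply_two_two_of_trace h
  ext i j
  fin_cases i <;> fin_cases j <;>
    simp [okmul_apply, okE, Matrix.trace_fin_three] <;> grind

theorem okE_okmul {x : OkM} (h : x.trace = 0) :
    okmul okE x = !![x 0 0, okRoot * x 0 1, okRoot * x 0 2;
      (1 - okRoot) * x 1 0, x 2 2, -x 1 2;
      (1 - okRoot) * x 2 0, -x 2 1, x 1 1] := by
  have := apply_two_two_of_trace h
  ext i j
  fin_cases i <;> fin_cases j <;>
    simp [okmul_apply, okE, Matrix.trace_fin_three] <;> grind

/-- Conjugation is the reflection `x ↦ n(x, e) e - x`, as `n(x, e)` is the upper left entry. -/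
theorem okConj_eq {x : OkM} (h : x.trace = 0) : okConj x = x 0 0 • okE - x := by
  have hx := apply_two_two_of_trace h
  have hw := okRoot_sq
  rw [okConj, okmul_okE (trace_okmul _ _), okmul_okE (trace_okmul _ _), okmul_okE h]
  ext i j
  fin_cases i <;> fin_cases j <;> simp [okE] <;> grind

theorem okConj_trace (x : OkM) : (okConj x).trace = 0 := trace_okmul _ _

theorem okConj_okConj {x : OkM} (h : x.trace = 0) : okConj (okConj x) = x := by
  rw [okConj_eq (okConj_trace x), okConj_eq h]
  have : okE 0 0 = 2 := by simp [okE]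
  rw [Matrix.sub_apply, Matrix.smul_apply, this]
  module

theorem okmul_okE_okmul_okE {x : OkM} (h : x.trace = 0) : okmul (okmul okE x) okE = x := by
  have hw := okRoot_sq
  rw [okmul_okE (trace_okmul _ _), okE_okmul h]
  ext i j
  fin_cases i <;> fin_cases j <;> simp <;> grind

theorem okConj_okDmul {x y : OkM} (hx : x.trace = 0) (hy : y.trace = 0) :
    okConj (okDmul x y) = okDmul (okConj y) (okConj x) := by
  have hx' := apply_two_two_of_trace hx
  have hy' := apply_two_two_of_trace hy
  have hw := okRoot_sq
  rw [okDmul, okDmul, okConj_eq (trace_okmul _ _)]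
  rw [okE_okmul hx, okmul_okE hy, okE_okmul (okConj_trace y), okmul_okE (okConj_trace x),
    okConj_eq hx, okConj_eq hy]
  ext i j
  fin_cases i <;> fin_cases j <;>
    simp [okmul_apply, okE, Matrix.mul_apply, Fin.sum_univ_three, Matrix.trace_fin_three,
      hx', hy'] <;> grind

theorem okDmul_okConj {x : OkM} (hx : x.trace = 0) :
    okDmul x (okConj x) = ((x * x).trace / 6) • okE := by
  have hx' := apply_two_two_of_trace hx
  have hw := okRoot_sq
  rw [okDmul, okE_okmul hx, okmul_okE (okConj_trace x), okConj_eq hx]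
  ext i j
  fin_cases i <;> fin_cases j <;>
    simp [okmul_apply, okE, Matrix.mul_apply, Fin.sum_univ_three, Matrix.trace_fin_three,
      hx'] <;> grind

theorem ofReal_oknorm {x : OkM} (hx : x.IsHermitian) : (oknorm x : ℂ) = (x * x).trace / 6 := by
  have h : (starRingEnd ℂ) ((1 / 6 : ℂ) * (x * x).trace) = (1 / 6 : ℂ) * (x * x).trace := by
    rw [map_mul, starRingEnd_apply (x * x).trace, ← Matrix.trace_conjTranspose,
      Matrix.conjTranspose_mul, hx.eq]
    simp only [map_div₀, map_one, map_ofNat]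
  rw [oknorm, Complex.conj_eq_iff_re.mp h]
  ring

/-- STATEMENT 17: properties of the conjugation conj(x) = ((x*e)*e)*e with respect to
the derived octonionic product x·y = (e*x)*(y*e). -/
theorem okubo_conjugation_properties :
    (∀ x : OkM, IsOkubo x → okConj x = okTau (okmul okE x)) ∧
    (∀ x : OkM, IsOkubo x → okConj (okConj x) = x) ∧
    (∀ x y : OkM, IsOkubo x → IsOkubo y →
      okConj (okDmul x y) = okDmul (okConj y) (okConj x)) ∧
    (∀ x : OkM, IsOkubo x → okDmul x (okConj x) = oknorm x • okE) := by
  refine ⟨fun x hx => ?_, fun x hx => okConj_okConj hx.2,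
    fun x y hx hy => okConj_okDmul hx.2 hy.2, fun x hx => ?_⟩
  · rw [okTau, okmul_okE_okmul_okE hx.2, okConj]
  · rw [okDmul_okConj hx.2, ← ofReal_oknorm hx.1, Complex.coe_smul]
end
end
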